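/- There are absolute constants c₀ ≥ 10 and 0 < c₁ < c₂ and c₃ > 0 such that for every real c ≥ c₀ the following holds. Let m be a sufficiently large integer and let n = (1 − ε)·m be an integer with m^{−1/3} ≤ ε ≤ 1/c. Fix any history-independent insertion/deletion model at size n on m slots and let j ∈ J. Draw r uniform in {⌈n/4⌉, …, ⌊n/2⌋}, start from A ∼ 𝒞_n, perform an insertion at rank r followed by a deletion at rank n+1, and let q_j be the number of elements rearranged by either operation whose rank r' after the insertion satisfies c₁·j ≤ |r − r'| ≤ c₂·j. Then E[q_j] ≥ c₃/(Δ_j + 1/j). -/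

import Mathlib

open scoped BigOperators Classical

/-- Read slot `i` (mod `m`) of a cyclic array of `m` boolean slots. -/
def cyc (m : ℕ) (A : Fin m → Bool) (i : ℕ) : Bool :=
  if h : 0 < m then A ⟨i % m, Nat.mod_lt i h⟩ else false

/-- Number of occupied slots among the `j` cyclically consecutive slots
`p, p+1, …, p+j-1`. -/
def blockCount (m : ℕ) (A : Fin m → Bool) (p j : ℕ) : ℕ :=
  ((Finset.range j).filter (fun t => cyc m A (p + t) = true)).card

/-- Density of the `j`-block starting at slot `p`. -/
noncomputable def blockDensity (m : ℕ) (A : Fin m → Bool) (p j : ℕ) : ℝ :=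
  (blockCount m A p j : ℝ) / j

/-- A block is live (w.r.t. constant `c` and sparsity `ε`) if its density is
at least `1 - c·ε`. -/
def IsLive (c ε : ℝ) (m : ℕ) (A : Fin m → Bool) (p j : ℕ) : Prop :=
  1 - c * ε ≤ blockDensity m A p j

/-- Imbalance of a `j`-block (for even `j`): difference of the densities of its
two halves. -/
noncomputable def imbalance (m : ℕ) (A : Fin m → Bool) (p j : ℕ) : ℝ :=
  |blockDensity m A p (j / 2) - blockDensity m A (p + j / 2) (j / 2)|

/-- Adjusted imbalance: the imbalance if the block is live, `0` if it is dead. -/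
noncomputable def adjImbalance (c ε : ℝ) (m : ℕ) (A : Fin m → Bool) (p j : ℕ) : ℝ :=
  if IsLive c ε m A p j then imbalance m A p j else 0

/-- `Δ_j(A)`: the average adjusted imbalance over all `m` `j`-blocks. -/
noncomputable def DeltaAvg (c ε : ℝ) (m : ℕ) (A : Fin m → Bool) (j : ℕ) : ℝ :=
  (∑ p ∈ Finset.range m, adjImbalance c ε m A p j) / m

/-- `J = {2, 4, 8, …, 2^(⌊log₂ m⌋ - 2)}`. -/
def Jset (m : ℕ) : Finset ℕ := (Finset.Icc 1 (Nat.log 2 m - 2)).image (fun i => 2 ^ i)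

/-- The potential `φ` of a `j`-block: `0` if dead, `(μ - (1 - c·ε))²` if live,
where `μ` is its density. -/
noncomputable def potential (c ε : ℝ) (m : ℕ) (A : Fin m → Bool) (p j : ℕ) : ℝ :=
  if IsLive c ε m A p j then (blockDensity m A p j - (1 - c * ε)) ^ 2 else 0

/-- An array configuration on `m` slots with `k` elements: a boolean occupancy
vector with exactly `k` occupied slots. -/
abbrev Config (m k : ℕ) :=
  {A : Fin m → Bool // (Finset.univ.filter (fun i => A i = true)).card = k}

/-- Expectation of a real-valued function under a probability mass function on a
finite type. -/
noncomputable def pexp {α : Type*} [Fintype α] (p : PMF α) (f : α → ℝ) : ℝ :=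
  ∑ a, (p a).toReal * f a

/-- Probability of an event under a probability mass function on a finite type. -/
noncomputable def pprob {α : Type*} [Fintype α] (p : PMF α) (E : α → Prop) : ℝ :=
  pexp p (fun a => if E a then 1 else 0)

/-- `posOf A s` is the position (0-indexed slot) of the rank-`s` element of `A`,
i.e. the `s`-th smallest occupied slot (`s` is 1-indexed). -/
def posOf {m : ℕ} (A : Fin m → Bool) (s : ℕ) : ℕ :=
  (((List.range m).filter (fun i => cyc m A i))).getD (s - 1) 0

/-- A history-independent insertion/deletion model at size `n` on `m` slots:
distributions `C0` (on `n`-element configurations) and `C1` (on `(n+1)`-element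
configurations), insertion couplings `ins r` for each rank `r ∈ {1, …, n+1}`,
and a deletion coupling `del` for rank `n+1`, all with marginals `C0` and `C1`. -/
structure HIModel (m n : ℕ) where
  C0 : PMF (Config m n)
  C1 : PMF (Config m (n + 1))
  ins : ℕ → PMF (Config m n × Config m (n + 1))
  del : PMF (Config m n × Config m (n + 1))
  ins_fst : ∀ r, 1 ≤ r → r ≤ n + 1 → PMF.map Prod.fst (ins r) = C0
  ins_snd : ∀ r, 1 ≤ r → r ≤ n + 1 → PMF.map Prod.snd (ins r) = C1
  del_fst : PMF.map Prod.fst del = C0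
  del_snd : PMF.map Prod.snd del = C1

/-- The coupling `p` conditioned on its first coordinate being `A` (junk value
`p` itself when the conditioning event is null; such states are reached with
probability zero). -/
noncomputable def condFst {m n : ℕ} (p : PMF (Config m n × Config m (n + 1)))
    (A : Config m n) : PMF (Config m n × Config m (n + 1)) :=
  if h : ∃ q ∈ {q : Config m n × Config m (n + 1) | q.1 = A}, q ∈ p.support then
    p.filter {q | q.1 = A} h
  else p

/-- The coupling `p` conditioned on its second coordinate being `A'`. -/
noncomputable def condSnd {m n : ℕ} (p : PMF (Config m n × Config m (n + 1)))
    (A' : Config m (n + 1)) : PMF (Config m n × Config m (n + 1)) :=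
  if h : ∃ q ∈ {q : Config m n × Config m (n + 1) | q.2 = A'}, q ∈ p.support then
    p.filter {q | q.2 = A'} h
  else p

/-- Rank of an old element after an insertion at rank `r`. -/
def insShift (r s : ℕ) : ℕ := if s < r then s else s + 1

/-- The (cyclic) slots of the 1st, `(j/2)`-th and `j`-th positions of the
`j`-block starting at slot `p`: the slots of the boundary set `B(x)`. -/
def boundarySlots (m p j : ℕ) : Finset ℕ :=
  {p % m, (p + j / 2 - 1) % m, (p + j - 1) % m}

/-- An insertion at rank `r` realized by the pair `(A0, A1)` is critical to the
`j`-block of `A0` starting at slot `p`: the block is live in `A0` and some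
element of its boundary set is rearranged. -/
def InsCritical (c : ℝ) (m n r j p : ℕ) (A0 : Config m n) (A1 : Config m (n + 1)) : Prop :=
  IsLive c (1 - (n : ℝ) / m) m A0.1 p j ∧
  ∃ s ∈ Finset.Icc 1 n, posOf A0.1 s ∈ boundarySlots m p j ∧
    posOf A0.1 s ≠ posOf A1.1 (insShift r s)

/-- A deletion at rank `n+1` realized by the pair `(A0, A1)` (`A1` before, `A0`
after) is critical to the `j`-block of `A1` starting at slot `p`. -/
def DelCritical (c : ℝ) (m n j p : ℕ) (A0 : Config m n) (A1 : Config m (n + 1)) : Prop :=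
  IsLive c (1 - ((n : ℝ) + 1) / m) m A1.1 p j ∧
  ∃ s ∈ Finset.Icc 1 n, posOf A1.1 s ∈ boundarySlots m p j ∧
    posOf A1.1 s ≠ posOf A0.1 s

/-- Probability that, starting from configuration `A` and performing `k`
insertion/deletion pairs (insertion at rank `r`, deletion at rank `n+1`),
no operation is critical to the `j`-block starting at the position of the
current rank-`t` element (in the configuration just before that operation). -/
noncomputable def probNoCrit (c : ℝ) {m n : ℕ} (Mo : HIModel m n) (t r j : ℕ) :
    ℕ → Config m n → ℝ
  | 0, _ => 1
  | k + 1, A =>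
      pexp (condFst (Mo.ins r) A) fun q =>
        if InsCritical c m n r j (posOf q.1.1 t) q.1 q.2 then 0
        else pexp (condSnd Mo.del q.2) fun q' =>
          if DelCritical c m n j (posOf q'.2.1 t) q'.1 q'.2 then 0
          else probNoCrit c Mo t r j k q'.1

/-- `Δ_j` for the stationary distribution `C0` of a model. -/
noncomputable def DeltaExp (c : ℝ) {m n : ℕ} (Mo : HIModel m n) (j : ℕ) : ℝ :=
  pexp Mo.C0 (fun A => DeltaAvg c (1 - (n : ℝ) / m) m A.1 j)

/-- Number of elements rearranged by an insertion at rank `r` (realized by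
`(A0, A1)`) or by the subsequent deletion at rank `n+1` (realized by
`(A2, A1)`), whose rank `s'` after the insertion satisfies
`c1·j ≤ |r - s'| ≤ c2·j`. -/
noncomputable def rearrCount (c1 c2 : ℝ) (m n r j : ℕ)
    (A0 : Config m n) (A1 : Config m (n + 1)) (A2 : Config m n) : ℕ :=
  ((Finset.Icc 1 (n + 1)).filter (fun (s' : ℕ) =>
    c1 * j ≤ |(r : ℝ) - (s' : ℝ)| ∧ |(r : ℝ) - (s' : ℝ)| ≤ c2 * j ∧
    ((∃ s ∈ Finset.Icc 1 n, insShift r s = s' ∧ posOf A0.1 s ≠ posOf A1.1 s') ∨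
     (s' ≤ n ∧ posOf A1.1 s' ≠ posOf A2.1 s')))).card

/-- Number of occupied slots strictly before slot `x`. -/
def Ncnt (m : ℕ) (A : Fin m → Bool) (x : ℕ) : ℕ := Nat.count (fun i => cyc m A i = true) x

lemma Ncnt_succ {m : ℕ} {A : Fin m → Bool} {x : ℕ} (h : cyc m A x = true) :
    Ncnt m A (x + 1) = Ncnt m A x + 1 := by
  simp [Ncnt, Nat.count_succ, h]

lemma Ncnt_add (m : ℕ) (A : Fin m → Bool) (p l : ℕ) :
    Ncnt m A (p + l) = Ncnt m A p + blockCount m A p l := by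
  simp only [Ncnt, Nat.count_add, blockCount]
  rw [Nat.count_eq_card_filter_range (fun t => cyc m A (p + t) = true) l]

lemma blockCount_le (m : ℕ) (A : Fin m → Bool) (p l : ℕ) : blockCount m A p l ≤ l := by
  unfold blockCount
  exact (Finset.card_filter_le _ _).trans (by simp)

lemma Ncnt_mono (m : ℕ) (A : Fin m → Bool) : Monotone (Ncnt m A) := Nat.count_monotone _

lemma cyc_lt {m : ℕ} (A : Fin m → Bool) {x : ℕ} (h : x < m) : cyc m A x = A ⟨x, h⟩ := by
  have : 0 < m := by omega
  simp [cyc, this, Nat.mod_eq_of_lt h]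

lemma Ncnt_total {m k : ℕ} (A : Config m k) : Ncnt m A.1 m = k := by
  have h := A.2
  rw [Ncnt, Nat.count_eq_card_filter_range]
  refine Eq.trans (Eq.symm ?_) h
  apply Finset.card_bij (fun (i : Fin m) _ => (i : ℕ))
  · intro i hi
    simp only [Finset.mem_filter, Finset.mem_univ, true_and] at hi
    simp [cyc_lt A.1 i.2, hi]
  · intro a _ b _ hab
    exact Fin.ext hab
  · intro b hb
    simp only [Finset.mem_filter, Finset.mem_range] at hb
    refine ⟨⟨b, hb.1⟩, ?_, rfl⟩
    simp [← cyc_lt A.1 hb.1, hb.2]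

lemma filter_range_split (P : ℕ → Bool) (m x : ℕ) (hx : x < m) :
    ∃ l, (List.range m).filter P = (List.range x).filter P ++ ([x].filter P ++ l) := by
  obtain ⟨d, rfl⟩ := Nat.exists_eq_add_of_lt hx
  rw [show x + d + 1 = (x + 1) + d by omega, List.range_add, List.range_succ]
  rw [List.filter_append, List.filter_append, List.append_assoc]
  exact ⟨_, rfl⟩

lemma filter_length (m : ℕ) (A : Fin m → Bool) (x : ℕ) :
    ((List.range x).filter (fun i => cyc m A i)).length = Ncnt m A x := by
  rw [Ncnt, Nat.count, List.countP_eq_length_filter]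
  simp

lemma posOf_of_occ {m : ℕ} (A : Fin m → Bool) {x : ℕ} (hx : x < m) (h : cyc m A x = true) :
    posOf A (Ncnt m A x + 1) = x := by
  obtain ⟨l, hl⟩ := filter_range_split (fun i => cyc m A i) m x hx
  unfold posOf
  rw [hl, List.getD_append_right _ _ _ _ (by rw [filter_length]; omega), filter_length]
  simp [h]

lemma posOf_spec {m k : ℕ} (A : Config m k) {s : ℕ} (h1 : 1 ≤ s) (h2 : s ≤ k) :
    posOf A.1 s < m ∧ cyc m A.1 (posOf A.1 s) = true ∧ Ncnt m A.1 (posOf A.1 s) + 1 = s := by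
  set l := (List.range m).filter (fun i => cyc m A.1 i) with hl
  have hlen : l.length = k := by rw [hl, filter_length, Ncnt_total]
  have hs : s - 1 < l.length := by omega
  have hp : posOf A.1 s = l[s-1] := by
    unfold posOf
    rw [← hl, List.getD_eq_getElem _ _ hs]
  have hmem : posOf A.1 s ∈ l := by rw [hp]; exact List.getElem_mem hs
  have hmem2 := hmem
  rw [hl, List.mem_filter, List.mem_range] at hmem2
  refine ⟨hmem2.1, hmem2.2, ?_⟩
  have hq := posOf_of_occ A.1 hmem2.1 hmem2.2
  set y := posOf A.1 s with hy
  have hN : Ncnt m A.1 y + 1 ≤ k := by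
    rw [← Ncnt_succ hmem2.2]
    exact (Ncnt_mono _ _ (by omega)).trans (Ncnt_total A).le
  have hN' : Ncnt m A.1 y < l.length := by omega
  have hq2 : l[Ncnt m A.1 y] = y := by
    conv_rhs => rw [← hq]
    unfold posOf
    rw [← hl, List.getD_eq_getElem _ _ (by simpa using hN')]
    simp
  have hnd : l.Nodup := List.nodup_range.filter _
  have := (List.Nodup.getElem_inj_iff hnd (hi := hN') (hj := hs)).1 (by rw [hq2, hp])
  omega

/-- The rearrangement condition in `rearrCount`. -/
def Rearr {m n : ℕ} (r : ℕ) (A0 : Config m n) (A1 : Config m (n + 1)) (A2 : Config m n)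
    (s' : ℕ) : Prop :=
  (∃ s ∈ Finset.Icc 1 n, insShift r s = s' ∧ posOf A0.1 s ≠ posOf A1.1 s') ∨
     (s' ≤ n ∧ posOf A1.1 s' ≠ posOf A2.1 s')

lemma not_rearr {m n r : ℕ} {A0 : Config m n} {A1 : Config m (n + 1)} {A2 : Config m n}
    {s' x : ℕ} (hx : x < m) (ho : cyc m A0.1 x = true)
    (hs : insShift r (Ncnt m A0.1 x + 1) = s') (hn : s' ≤ n) (hr : ¬ Rearr r A0 A1 A2 s') :
    cyc m A2.1 x = true ∧ Ncnt m A2.1 x + 1 = s' := by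
  have h0 := posOf_of_occ A0.1 hx ho
  have hN : Ncnt m A0.1 x + 1 ≤ n := by
    have h1 : Ncnt m A0.1 (x+1) ≤ Ncnt m A0.1 m := Ncnt_mono _ _ (by omega)
    rw [Ncnt_succ ho, Ncnt_total] at h1
    exact h1
  unfold Rearr at hr
  push Not at hr
  have e1 := hr.1 _ (Finset.mem_Icc.2 ⟨by omega, hN⟩) hs
  have e2 := hr.2 hn
  have h1s : 1 ≤ s' := by rw [← hs]; unfold insShift; split_ifs <;> omega
  have := posOf_spec A2 h1s hn
  rw [← e2, ← e1, h0] at this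
  exact this.2

lemma empty_shift {m n : ℕ} (A : Config m n) (t : ℕ) :
    ((Finset.range m).filter (fun p => p + t < m ∧ ¬ cyc m A.1 (p + t) = true)).card ≤ m - n := by
  have h1 : ((Finset.range m).filter (fun x => ¬ cyc m A.1 x = true)).card = m - n := by
    have h := Finset.card_filter_add_card_filter_not (s := Finset.range m)
      (fun x => cyc m A.1 x = true)
    have h2 := Ncnt_total A
    rw [Ncnt, Nat.count_eq_card_filter_range] at h2
    rw [h2, Finset.card_range] at h
    omega
  rw [← h1]
  apply Finset.card_le_card_of_injOn (fun p => p + t)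
  · intro p hp
    simp only [Finset.coe_filter, Finset.mem_range, Set.mem_ofPred_eq] at hp ⊢
    exact hp.2
  · intro a _ b _ hab
    simpa using hab

/-- Total emptiness of the windows of length `l` lying inside the array. -/
lemma empty_sum {m n : ℕ} (A : Config m n) (l J : ℕ) (hl : l ≤ J) :
    ∑ p ∈ (Finset.range m).filter (fun p => p + J < m), (l - blockCount m A.1 p l) ≤ l * (m - n) := by
  have e : ∀ p, l - blockCount m A.1 p l
      = ∑ t ∈ Finset.range l, if ¬ cyc m A.1 (p + t) = true then 1 else 0 := by
    intro p
    have h := Finset.card_filter_add_card_filter_not (s := Finset.range l)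
      (fun t => cyc m A.1 (p + t) = true)
    rw [Finset.card_range] at h
    rw [← Finset.card_filter]
    unfold blockCount
    omega
  simp_rw [e]
  rw [Finset.sum_comm]
  calc _ ≤ ∑ t ∈ Finset.range l, (m - n) := by
        apply Finset.sum_le_sum
        intro t ht
        rw [Finset.mem_range] at ht
        rw [← Finset.card_filter]
        refine le_trans (Finset.card_le_card ?_) (empty_shift A t)
        intro p hp
        simp only [Finset.mem_filter, Finset.mem_range] at hp ⊢
        refine ⟨hp.1.1, by omega, hp.2⟩
    _ = _ := by simp
section prob
variable {α β : Type*} [Fintype α] [Fintype β]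

lemma pexp_mono (p : PMF α) {f g : α → ℝ} (h : ∀ a, f a ≤ g a) : pexp p f ≤ pexp p g :=
  Finset.sum_le_sum fun a _ => mul_le_mul_of_nonneg_left (h a) ENNReal.toReal_nonneg

lemma pexp_add (p : PMF α) (f g : α → ℝ) : pexp p (fun a => f a + g a) = pexp p f + pexp p g := by
  simp [pexp, mul_add, Finset.sum_add_distrib]

lemma pexp_smul (p : PMF α) (k : ℝ) (f : α → ℝ) : pexp p (fun a => k * f a) = k * pexp p f := by
  simp only [pexp, Finset.mul_sum]
  exact Finset.sum_congr rfl fun a _ => by ring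

lemma pexp_sum {ι : Type*} (s : Finset ι) (p : PMF α) (f : ι → α → ℝ) :
    pexp p (fun a => ∑ i ∈ s, f i a) = ∑ i ∈ s, pexp p (f i) := by
  simp only [pexp, Finset.mul_sum]
  rw [Finset.sum_comm]

lemma sum_toReal (p : PMF α) : ∑ a, (p a).toReal = 1 := by
  rw [← ENNReal.toReal_sum (fun a _ => p.apply_ne_top a)]
  have := p.tsum_coe
  rw [tsum_fintype] at this
  rw [this]; simp

lemma pexp_const (p : PMF α) (k : ℝ) : pexp p (fun _ => k) = k := by
  simp [pexp, ← Finset.sum_mul, sum_toReal]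

lemma map_toReal {α β : Type*} [Fintype α] (p : PMF α) (g : α → β) (b : β) :
    ((PMF.map g p) b).toReal = ∑ a, if g a = b then (p a).toReal else 0 := by
  rw [PMF.map_apply, tsum_fintype, ENNReal.toReal_sum]
  · refine Finset.sum_congr rfl fun a _ => ?_
    by_cases h : g a = b
    · simp [h]
    · simp [h, Ne.symm h]
  · intro a _
    split_ifs
    · exact p.apply_ne_top a
    · simp

lemma pexp_map (p : PMF α) (g : α → β) (f : β → ℝ) :
    pexp (PMF.map g p) f = pexp p (fun a => f (g a)) := by
  simp only [pexp, map_toReal, Finset.sum_mul]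
  rw [Finset.sum_comm]
  refine Finset.sum_congr rfl fun a _ => ?_
  simp

/-- Disintegration. -/
lemma pexp_disint (p : PMF α) (g : α → β) (k : β → PMF α)
    (hk : ∀ b, ∀ h : ∃ q ∈ {q : α | g q = b}, q ∈ p.support, k b = p.filter {q | g q = b} h)
    (f : α → ℝ) :
    pexp (PMF.map g p) (fun b => pexp (k b) f) = pexp p f := by
  have key : ∀ b a, ((PMF.map g p) b).toReal * ((k b) a).toReal
      = if g a = b then (p a).toReal else 0 := by
    intro b a
    by_cases h : ∃ q ∈ {q : α | g q = b}, q ∈ p.support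
    · rw [hk b h, PMF.filter_apply]
      have hS : (∑' q, ({q | g q = b} : Set α).indicator p q) = (PMF.map g p) b := by
        rw [PMF.map_apply]
        refine tsum_congr fun q => ?_
        by_cases hq : g q = b
        · simp [hq]
        · simp [hq, Ne.symm hq]
      rw [hS]
      by_cases ha : g a = b
      · have hne : ((PMF.map g p) b) ≠ 0 := by
          obtain ⟨q, hq, hq2⟩ := h
          rw [← PMF.mem_support_iff, PMF.mem_support_map_iff]
          exact ⟨q, hq2, hq⟩
        have hne' : ((PMF.map g p) b).toReal ≠ 0 :=
          ENNReal.toReal_ne_zero.2 ⟨hne, PMF.apply_ne_top _ _⟩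
        simp only [Set.indicator, Set.mem_ofPred_eq, ha, if_true, ENNReal.toReal_mul,
          ENNReal.toReal_inv]
        field_simp
      · simp [ha]
    · have hz : ∀ q, g q = b → p q = 0 := by
        intro q hq
        by_contra hne
        exact h ⟨q, hq, (PMF.mem_support_iff _ _).2 hne⟩
      have : ((PMF.map g p) b).toReal = 0 := by
        rw [map_toReal]
        refine Finset.sum_eq_zero fun q _ => ?_
        split_ifs with hq
        · simp [hz q hq]
        · rfl
      rw [this, zero_mul]
      split_ifs with hq
      · simp [hz a hq]
      · rfl
  have : pexp (PMF.map g p) (fun b => pexp (k b) f)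
      = ∑ b, ∑ a, (if g a = b then (p a).toReal else 0) * f a := by
    unfold pexp
    refine Finset.sum_congr rfl fun b _ => ?_
    rw [Finset.mul_sum]
    refine Finset.sum_congr rfl fun a _ => ?_
    rw [← mul_assoc, key]
  rw [this, Finset.sum_comm]
  unfold pexp
  refine Finset.sum_congr rfl fun a _ => ?_
  simp

end prob

/-- Expectation over one insertion/deletion pair. -/
noncomputable def Ex {m n : ℕ} (Mo : HIModel m n) (r : ℕ)
    (F : Config m n → Config m (n + 1) → Config m n → ℝ) : ℝ :=
  pexp Mo.C0 (fun A => pexp (condFst (Mo.ins r) A) (fun q =>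
    pexp (condSnd Mo.del q.2) (fun q' => F q.1 q.2 q'.1)))

lemma Ex_eq {m n : ℕ} (Mo : HIModel m n) {r : ℕ} (h1 : 1 ≤ r) (h2 : r ≤ n + 1)
    (F : Config m n → Config m (n + 1) → Config m n → ℝ) :
    Ex Mo r F = pexp (Mo.ins r) (fun q => pexp (condSnd Mo.del q.2) (fun q' => F q.1 q.2 q'.1)) := by
  unfold Ex
  rw [← Mo.ins_fst r h1 h2]
  apply pexp_disint (Mo.ins r) Prod.fst (condFst (Mo.ins r))
  intro b h
  simp only [condFst]
  rw [dif_pos h]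

lemma Ex_fst {m n : ℕ} (Mo : HIModel m n) {r : ℕ} (h1 : 1 ≤ r) (h2 : r ≤ n + 1)
    (f : Config m n → ℝ) : Ex Mo r (fun A0 _ _ => f A0) = pexp Mo.C0 f := by
  rw [Ex_eq Mo h1 h2]
  simp only [pexp_const]
  rw [← Mo.ins_fst r h1 h2, pexp_map]

lemma Ex_last {m n : ℕ} (Mo : HIModel m n) {r : ℕ} (h1 : 1 ≤ r) (h2 : r ≤ n + 1)
    (f : Config m n → ℝ) : Ex Mo r (fun _ _ A2 => f A2) = pexp Mo.C0 f := by
  rw [Ex_eq Mo h1 h2]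
  rw [← pexp_map (Mo.ins r) Prod.snd (fun A1 => pexp (condSnd Mo.del A1) (fun q' => f q'.1)),
    Mo.ins_snd r h1 h2, ← Mo.del_snd, ← Mo.del_fst, pexp_map Mo.del Prod.fst]
  apply pexp_disint Mo.del Prod.snd (condSnd Mo.del) _ (fun q' => f q'.1)
  intro b h
  simp only [condSnd]
  rw [dif_pos h]

lemma Ex_mono {m n : ℕ} (Mo : HIModel m n) (r : ℕ)
    {F G : Config m n → Config m (n + 1) → Config m n → ℝ} (h : ∀ a b c, F a b c ≤ G a b c) :
    Ex Mo r F ≤ Ex Mo r G :=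
  pexp_mono _ fun _ => pexp_mono _ fun _ => pexp_mono _ fun _ => h _ _ _

lemma Ex_add {m n : ℕ} (Mo : HIModel m n) (r : ℕ)
    (F G : Config m n → Config m (n + 1) → Config m n → ℝ) :
    Ex Mo r (fun a b c => F a b c + G a b c) = Ex Mo r F + Ex Mo r G := by
  simp [Ex, pexp_add]

lemma Ex_smul {m n : ℕ} (Mo : HIModel m n) (r : ℕ) (k : ℝ)
    (F : Config m n → Config m (n + 1) → Config m n → ℝ) :
    Ex Mo r (fun a b c => k * F a b c) = k * Ex Mo r F := by
  simp [Ex, pexp_smul]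

/-- Potential argument: one-step stationarity. -/
lemma Ex_potential {m n : ℕ} (Mo : HIModel m n) {r : ℕ} (h1 : 1 ≤ r) (h2 : r ≤ n + 1)
    (g f : Config m n → ℝ) (K : ℝ) (q : Config m n → Config m (n + 1) → Config m n → ℝ)
    (h : ∀ a b c, g a + f a ≤ f c + K * q a b c) :
    pexp Mo.C0 g ≤ K * Ex Mo r q := by
  have := Ex_mono Mo r h
  rw [Ex_add Mo r (fun a _ _ => g a) (fun a _ _ => f a), Ex_add Mo r (fun _ _ c => f c),
    Ex_smul, Ex_fst Mo h1 h2, Ex_fst Mo h1 h2, Ex_last Mo h1 h2] at this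
  linarith
/-- The structural condition on the window at slot `p` w.r.t. insertion rank `r`. -/
def UU (m r h u p : ℕ) (A : Fin m → Bool) : Prop :=
  p + 2 * h < m ∧ cyc m A p = true ∧ cyc m A (p + h - 1) = true ∧ cyc m A (p + 2 * h) = true ∧
    Ncnt m A p + 1 + u ≤ r ∧ r + u ≤ Ncnt m A (p + h)

/-- Signed imbalance (in number of elements). -/
noncomputable def Iv (m h p : ℕ) (A : Fin m → Bool) : ℝ :=
  2 * (Ncnt m A (p + h) : ℝ) - Ncnt m A p - Ncnt m A (p + 2 * h)

noncomputable def fpot (L : ℝ) (m r h u p : ℕ) (A : Fin m → Bool) : ℝ :=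
  if UU m r h u p A then max (-L) (min L (Iv m h p A)) else -L

def Good (L : ℝ) (m r h u p : ℕ) (A : Fin m → Bool) : Prop :=
  UU m r h u p A ∧ -L ≤ Iv m h p A ∧ Iv m h p A ≤ L - 1

def Crit {m n : ℕ} (r h u p : ℕ) (A0 : Config m n) (A1 : Config m (n + 1)) (A2 : Config m n) :
    Prop :=
  UU m r h u p A0.1 ∧ (Rearr r A0 A1 A2 (Ncnt m A0.1 p + 1) ∨
    Rearr r A0 A1 A2 (Ncnt m A0.1 (p + h) + 1) ∨ Rearr r A0 A1 A2 (Ncnt m A0.1 (p + 2 * h) + 2))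

lemma UU_facts {m r h u p : ℕ} {A : Fin m → Bool} (hu : 1 ≤ u) (hU : UU m r h u p A) :
    1 ≤ h ∧ Ncnt m A (p + h - 1) + 1 = Ncnt m A (p + h) ∧
    Ncnt m A (p + h) ≤ Ncnt m A (p + 2 * h) ∧ Ncnt m A (p + h) ≤ Ncnt m A p + h ∧
    Ncnt m A (p + 2 * h) ≤ Ncnt m A p + 2 * h := by
  obtain ⟨h1, h2, h3, h4, h5, h6⟩ := hU
  have e1 := Ncnt_add m A p h
  have e2 := blockCount_le m A p h
  have e3 := Ncnt_add m A p (2 * h)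
  have e4 := blockCount_le m A p (2 * h)
  have hh : 1 ≤ h := by omega
  refine ⟨hh, ?_, Ncnt_mono m A (by omega), by omega, by omega⟩
  rw [← Ncnt_succ h3]
  congr 1
  omega

lemma noncrit_step {m n r h u p : ℕ} {A0 : Config m n} {A1 : Config m (n + 1)} {A2 : Config m n}
    (hu : 1 ≤ u) (hr : r + 2 * h + 2 ≤ n) (hU : UU m r h u p A0.1) (hc : ¬ Crit r h u p A0 A1 A2) :
    UU m r h u p A2.1 ∧ Iv m h p A2.1 = Iv m h p A0.1 + 1 := by
  obtain ⟨f1, f2, f3, f4, f5⟩ := UU_facts hu hU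
  have hc' : ¬ Rearr r A0 A1 A2 (Ncnt m A0.1 p + 1) ∧
    ¬ Rearr r A0 A1 A2 (Ncnt m A0.1 (p + h) + 1) ∧
    ¬ Rearr r A0 A1 A2 (Ncnt m A0.1 (p + 2 * h) + 2) := by
    refine ⟨fun hh => hc ⟨hU, Or.inl hh⟩, fun hh => hc ⟨hU, Or.inr (Or.inl hh)⟩,
      fun hh => hc ⟨hU, Or.inr (Or.inr hh)⟩⟩
  obtain ⟨h1, h2, h3, h4, h5, h6⟩ := hU
  have k1 := not_rearr (r := r) (by omega) h2 (by unfold insShift; rw [if_pos (by omega)])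
    (by omega) hc'.1
  have k2 := not_rearr (r := r) (by omega) h3
    (by unfold insShift; rw [if_neg (by omega), f2]) (by omega) hc'.2.1
  have k3 := not_rearr (r := r) (by omega) h4
    (by unfold insShift; rw [if_neg (by omega)]) (by omega) hc'.2.2
  have k4 : Ncnt m A2.1 (p + h) = Ncnt m A0.1 (p + h) + 1 := by
    rw [← k2.2, ← Ncnt_succ k2.1]
    congr 1
    omega
  have k5 : Ncnt m A2.1 p = Ncnt m A0.1 p := by omega
  have k6 : Ncnt m A2.1 (p + 2 * h) = Ncnt m A0.1 (p + 2 * h) + 1 := by omega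
  refine ⟨⟨h1, k1.1, k2.1, k3.1, by omega, by omega⟩, ?_⟩
  unfold Iv
  rw [k4, k5, k6]
  push_cast
  ring

lemma fpot_ge {L : ℝ} (m r h u p : ℕ) (A : Fin m → Bool) :
    -L ≤ fpot L m r h u p A := by
  unfold fpot
  split_ifs
  · exact le_max_left _ _
  · exact le_rfl

lemma fpot_le {L : ℝ} (hL : 0 ≤ L) (m r h u p : ℕ) (A : Fin m → Bool) :
    fpot L m r h u p A ≤ L := by
  unfold fpot
  split_ifs
  · exact max_le (by linarith) (min_le_left _ _)
  · linarith

lemma step_ineq {m n r h u p : ℕ} {L : ℝ} (hL : 0 ≤ L) (A0 : Config m n) (A1 : Config m (n + 1))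
    (A2 : Config m n) (hu : 1 ≤ u) (hr : r + 2 * h + 2 ≤ n) :
    (if Good L m r h u p A0.1 then (1 : ℝ) else 0) + fpot L m r h u p A0.1 ≤
      fpot L m r h u p A2.1 + (2 * L + 1) * (if Crit r h u p A0 A1 A2 then (1 : ℝ) else 0) := by
  have g2 := fpot_ge (L := L) m r h u p A2.1
  have g0 := fpot_le hL m r h u p A0.1
  by_cases hU : UU m r h u p A0.1
  · by_cases hc : Crit r h u p A0 A1 A2
    · rw [if_pos hc]
      split_ifs <;> linarith
    · obtain ⟨hU2, hI⟩ := noncrit_step hu hr hU hc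
      rw [if_neg hc]
      unfold fpot
      rw [if_pos hU, if_pos hU2, hI]
      split_ifs with hg
      · obtain ⟨_, hg1, hg2⟩ := hg
        rw [min_eq_right (by linarith), min_eq_right (by linarith), max_eq_right (by linarith),
          max_eq_right (by linarith)]
        linarith
      · have : max (-L) (min L (Iv m h p A0.1)) ≤ max (-L) (min L (Iv m h p A0.1 + 1)) :=
          max_le_max le_rfl (min_le_min le_rfl (by linarith))
        linarith
  · have hg : ¬ Good L m r h u p A0.1 := fun hh => hU hh.1
    have hc : ¬ Crit r h u p A0 A1 A2 := fun hh => hU hh.1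
    rw [if_neg hg, if_neg hc]
    have : fpot L m r h u p A0.1 = -L := by unfold fpot; rw [if_neg hU]
    linarith

lemma Ncnt_inj {m : ℕ} {A : Fin m → Bool} {x y : ℕ} (hx : cyc m A x = true)
    (hy : cyc m A y = true) (h : Ncnt m A x = Ncnt m A y) : x = y := by
  rcases lt_trichotomy x y with hl | hl | hl
  · have := Ncnt_mono m A (show x + 1 ≤ y from hl)
    rw [Ncnt_succ hx] at this; omega
  · exact hl
  · have := Ncnt_mono m A (show y + 1 ≤ x from hl)
    rw [Ncnt_succ hy] at this; omega

noncomputable def rset {m n : ℕ} (c1 c2 : ℝ) (r j : ℕ)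
    (A0 : Config m n) (A1 : Config m (n + 1)) (A2 : Config m n) : Finset ℕ :=
  (Finset.Icc 1 (n + 1)).filter (fun (s' : ℕ) =>
    c1 * j ≤ |(r : ℝ) - (s' : ℝ)| ∧ |(r : ℝ) - (s' : ℝ)| ≤ c2 * j ∧ Rearr r A0 A1 A2 s')

lemma rearrCount_eq {m n : ℕ} (c1 c2 : ℝ) (r j : ℕ)
    (A0 : Config m n) (A1 : Config m (n + 1)) (A2 : Config m n) :
    rearrCount c1 c2 m n r j A0 A1 A2 = (rset c1 c2 r j A0 A1 A2).card := by
  unfold rearrCount rset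
  congr 1
  ext s'
  simp only [Finset.mem_filter]
  rfl

lemma rearr_set {m n r u : ℕ} (A0 : Config m n) (A1 : Config m (n + 1)) (A2 : Config m n)
    {s' : ℕ} (h1 : 1 ≤ s') (h2 : s' ≤ n + 1) (hd : r + u ≤ s' ∨ s' + u ≤ r)
    (hd2 : s' ≤ r + 128 * u) (hd3 : r ≤ s' + 128 * u) (hR : Rearr r A0 A1 A2 s') :
    s' ∈ rset (1/64) 2 r (64 * u) A0 A1 A2 := by
  rw [rset, Finset.mem_filter]
  refine ⟨Finset.mem_Icc.2 ⟨h1, h2⟩, ?_, ?_, hR⟩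
  · push_cast
    rcases hd with hd | hd
    · have : (r : ℝ) + u ≤ s' := by exact_mod_cast hd
      rw [abs_sub_comm]
      exact le_trans (by linarith) (le_abs_self _)
    · have : (s' : ℝ) + u ≤ r := by exact_mod_cast hd
      exact le_trans (by linarith) (le_abs_self _)
  · push_cast
    have a : (s' : ℝ) ≤ r + 128 * u := by exact_mod_cast hd2
    have b : (r : ℝ) ≤ s' + 128 * u := by exact_mod_cast hd3
    rw [abs_le]; constructor <;> linarith

lemma crit_sum {m n r u : ℕ} (A0 : Config m n) (A1 : Config m (n + 1))
    (A2 : Config m n) (hu : 1 ≤ u) (hr : r + 64 * u + 2 ≤ n) :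
    ∑ p ∈ Finset.range m, (if Crit r (32 * u) u p A0 A1 A2 then (1 : ℝ) else 0) ≤
      3 * (rearrCount (1/64) 2 m n r (64 * u) A0 A1 A2 : ℝ) := by
  rw [← Finset.sum_filter, Finset.sum_const, nsmul_eq_mul, mul_one]
  rw [rearrCount_eq]
  set S := rset (1/64) 2 r (64 * u) A0 A1 A2 with hS
  set T1 := (Finset.range m).filter (fun p => UU m r (32 * u) u p A0.1 ∧
    Rearr r A0 A1 A2 (Ncnt m A0.1 p + 1))
  set T2 := (Finset.range m).filter (fun p => UU m r (32 * u) u p A0.1 ∧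
    Rearr r A0 A1 A2 (Ncnt m A0.1 (p + 32 * u) + 1))
  set T3 := (Finset.range m).filter (fun p => UU m r (32 * u) u p A0.1 ∧
    Rearr r A0 A1 A2 (Ncnt m A0.1 (p + 2 * (32 * u)) + 2))
  have c1 : T1.card ≤ S.card := by
    apply Finset.card_le_card_of_injOn (fun p => Ncnt m A0.1 p + 1)
    · intro p hp
      obtain ⟨-, hU, hR⟩ := Finset.mem_filter.1 hp
      obtain ⟨f1, f2, f3, f4, f5⟩ := UU_facts hu hU
      obtain ⟨h1, h2, h3, h4, h5, h6⟩ := hU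
      refine rearr_set A0 A1 A2 (s' := _) ?_ ?_ ?_ ?_ ?_ hR <;> beta_reduce <;> omega
    · intro p hp q hq hpq
      obtain ⟨-, hU, hR⟩ := Finset.mem_filter.1 hp
      obtain ⟨-, hU', hR'⟩ := Finset.mem_filter.1 hq
      exact Ncnt_inj hU.2.1 hU'.2.1 (by simpa using hpq)
  have c2 : T2.card ≤ S.card := by
    apply Finset.card_le_card_of_injOn (fun p => Ncnt m A0.1 (p + 32 * u) + 1)
    · intro p hp
      obtain ⟨-, hU, hR⟩ := Finset.mem_filter.1 hp
      obtain ⟨f1, f2, f3, f4, f5⟩ := UU_facts hu hU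
      obtain ⟨h1, h2, h3, h4, h5, h6⟩ := hU
      refine rearr_set A0 A1 A2 (s' := _) ?_ ?_ ?_ ?_ ?_ hR <;> beta_reduce <;> omega
    · intro p hp q hq hpq
      obtain ⟨-, hU, hR⟩ := Finset.mem_filter.1 hp
      obtain ⟨-, hU', hR'⟩ := Finset.mem_filter.1 hq
      have e1 := (UU_facts hu hU).2.1
      have e2 := (UU_facts hu hU').2.1
      have hpq' : Ncnt m A0.1 (p + 32 * u) = Ncnt m A0.1 (q + 32 * u) := by simpa using hpq
      have := Ncnt_inj hU.2.2.1 hU'.2.2.1 (by omega)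
      omega
  have c3 : T3.card ≤ S.card := by
    apply Finset.card_le_card_of_injOn (fun p => Ncnt m A0.1 (p + 2 * (32 * u)) + 2)
    · intro p hp
      obtain ⟨-, hU, hR⟩ := Finset.mem_filter.1 hp
      obtain ⟨f1, f2, f3, f4, f5⟩ := UU_facts hu hU
      obtain ⟨h1, h2, h3, h4, h5, h6⟩ := hU
      refine rearr_set A0 A1 A2 (s' := _) ?_ ?_ ?_ ?_ ?_ hR <;> beta_reduce <;> omega
    · intro p hp q hq hpq
      obtain ⟨-, hU, hR⟩ := Finset.mem_filter.1 hp
      obtain ⟨-, hU', hR'⟩ := Finset.mem_filter.1 hq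
      have := Ncnt_inj hU.2.2.2.1 hU'.2.2.2.1 (by simpa using hpq)
      omega
  have c4 : ((Finset.range m).filter (fun p => Crit r (32 * u) u p A0 A1 A2)).card
      ≤ T1.card + T2.card + T3.card := by
    refine le_trans (Finset.card_le_card (t := T1 ∪ T2 ∪ T3) ?_)
      ((Finset.card_union_le _ _).trans (Nat.add_le_add_right (Finset.card_union_le _ _) _))
    intro p hp
    obtain ⟨hp0, hU, hR⟩ := Finset.mem_filter.1 hp
    simp only [Finset.mem_union, T1, T2, T3, Finset.mem_filter]
    tauto
  have c5 : ((Finset.range m).filter (fun p => Crit r (32 * u) u p A0 A1 A2)).card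
      ≤ 3 * S.card := by omega
  exact_mod_cast c5

lemma main_r {m n r u : ℕ} {L : ℝ} (hL : 0 ≤ L) (Mo : HIModel m n) (h1 : 1 ≤ r) (hu : 1 ≤ u)
    (hr : r + 64 * u + 2 ≤ n) :
    pexp Mo.C0 (fun A => ∑ p ∈ Finset.range m,
      if Good L m r (32 * u) u p A.1 then (1 : ℝ) else 0) ≤
    (3 * (2 * L + 1)) * Ex Mo r (fun a b c => (rearrCount (1/64) 2 m n r (64 * u) a b c : ℝ)) := by
  apply Ex_potential Mo h1 (by omega) _
    (fun A => ∑ p ∈ Finset.range m, fpot L m r (32 * u) u p A.1)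
  intro a b c
  have := crit_sum a b c hu hr
  have h2 : ∑ p ∈ Finset.range m, _ ≤ ∑ p ∈ Finset.range m, _ :=
    Finset.sum_le_sum fun p _ => step_ineq (p := p) hL a b c hu (show r + 2 * (32 * u) + 2 ≤ n by omega)
  rw [Finset.sum_add_distrib, Finset.sum_add_distrib, ← Finset.mul_sum] at h2
  have h3 := mul_le_mul_of_nonneg_left this (show 0 ≤ 2 * L + 1 by linarith)
  linarith
lemma rank_count {m n : ℕ} (A : Config m n) (a b : ℕ) (hb : b < n) (Q : ℕ → Prop) [DecidablePred Q]
    (hQ : ∀ p, p < m → cyc m A.1 p = true → a ≤ Ncnt m A.1 p → Ncnt m A.1 p ≤ b → Q p) :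
    b + 1 ≤ ((Finset.range m).filter Q).card + a := by
  have : (Finset.Icc a b).card ≤ ((Finset.range m).filter Q).card := by
    apply Finset.card_le_card_of_injOn (fun v => posOf A.1 (v + 1))
    · intro v hv
      have hv' := Finset.mem_Icc.1 hv
      obtain ⟨h1, h2, h3⟩ := posOf_spec A (s := v + 1) (by omega) (by omega)
      change posOf A.1 (v + 1) ∈ _
      exact Finset.mem_filter.2 ⟨Finset.mem_range.2 h1, hQ _ h1 h2 (by omega) (by omega)⟩
    · intro v hv w hw hvw
      have hv' := Finset.mem_Icc.1 hv
      have hw' := Finset.mem_Icc.1 hw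
      obtain ⟨h1, h2, h3⟩ := posOf_spec A (s := v + 1) (by omega) (by omega)
      obtain ⟨h1', h2', h3'⟩ := posOf_spec A (s := w + 1) (by omega) (by omega)
      have hvw' : posOf A.1 (v + 1) = posOf A.1 (w + 1) := hvw
      rw [hvw'] at h3
      omega
  rw [Nat.card_Icc] at this
  omega

lemma pos_le {m n : ℕ} (A : Config m n) {p : ℕ} (hp : p < m) : p + n ≤ Ncnt m A.1 p + m := by
  have h1 := Ncnt_add m A.1 p (m - p)
  have h2 := blockCount_le m A.1 p (m - p)
  rw [show p + (m - p) = m by omega] at h1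
  have h3 := Ncnt_total A
  omega

lemma sparse_half {m n u : ℕ} (hu : 1 ≤ u) (A : Config m n) :
    ((Finset.range m).filter (fun p => p + 64 * u < m ∧ blockCount m A.1 p (32 * u) < 16 * u)).card
      ≤ 2 * (m - n) := by
  have h := empty_sum A (32 * u) (64 * u) (by omega)
  set B := (Finset.range m).filter
    (fun p => p + 64 * u < m ∧ blockCount m A.1 p (32 * u) < 16 * u) with hB
  have h2 : B.card * (16 * u) ≤ ∑ p ∈ (Finset.range m).filter (fun p => p + 64 * u < m),
      (32 * u - blockCount m A.1 p (32 * u)) := by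
    calc B.card * (16 * u) = ∑ p ∈ B, 16 * u := by simp
      _ ≤ ∑ p ∈ B, (32 * u - blockCount m A.1 p (32 * u)) := by
          apply Finset.sum_le_sum
          intro p hp
          have := (Finset.mem_filter.1 hp).2.2
          omega
      _ ≤ _ := by
          apply Finset.sum_le_sum_of_subset
          intro p hp
          have := Finset.mem_filter.1 hp
          exact Finset.mem_filter.2 ⟨this.1, this.2.1⟩
  have h3 : (16 * u) * B.card ≤ (16 * u) * (2 * (m - n)) := by nlinarith
  exact Nat.le_of_mul_le_mul_left h3 (by omega)

lemma dead_count {m n j : ℕ} {c ε : ℝ} (hj : 1 ≤ j) (hc : 0 < c) (hε : 0 < ε) (hnm : n ≤ m)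
    (he : ε * m = (m : ℝ) - n) (A : Config m n) :
    (((Finset.range m).filter (fun p => p + j < m ∧ ¬ IsLive c ε m A.1 p j)).card : ℝ)
      ≤ m / c := by
  have h := empty_sum A j j le_rfl
  set B := (Finset.range m).filter (fun p => p + j < m ∧ ¬ IsLive c ε m A.1 p j) with hB
  have hj' : (0 : ℝ) < j := by exact_mod_cast hj
  have h1 : (B.card : ℝ) * (c * ε * j) ≤ ∑ p ∈ B, ((j - blockCount m A.1 p j : ℕ) : ℝ) := by
    calc (B.card : ℝ) * (c * ε * j) = ∑ p ∈ B, c * ε * j := by simp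
      _ ≤ _ := by
          apply Finset.sum_le_sum
          intro p hp
          have h2 := (Finset.mem_filter.1 hp).2.2
          unfold IsLive blockDensity at h2
          rw [not_le, div_lt_iff₀ hj'] at h2
          rw [Nat.cast_sub (blockCount_le _ _ _ _)]
          nlinarith
  have h2 : ∑ p ∈ B, (j - blockCount m A.1 p j : ℕ) ≤ j * (m - n) := by
    refine le_trans (Finset.sum_le_sum_of_subset ?_) h
    intro p hp
    have := Finset.mem_filter.1 hp
    exact Finset.mem_filter.2 ⟨this.1, this.2.1⟩
  have h3 : ∑ p ∈ B, ((j - blockCount m A.1 p j : ℕ) : ℝ) ≤ j * (ε * m) := by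
    rw [he, ← Nat.cast_sub hnm]
    exact_mod_cast h2
  rw [le_div_iff₀ hc]
  have h4 : (ε * j) * (B.card * c) ≤ (ε * j) * m := by nlinarith
  exact le_of_mul_le_mul_left h4 (by positivity)

lemma Iv_eq (m h p : ℕ) (hh : 1 ≤ h) (A : Fin m → Bool) :
    |Iv m h p A| = h * imbalance m A p (2 * h) := by
  have hh' : (0 : ℝ) < h := by exact_mod_cast hh
  have e1 := Ncnt_add m A p h
  have e2 := Ncnt_add m A (p + h) h
  unfold imbalance blockDensity Iv
  rw [show 2 * h / 2 = h by omega, ← sub_div, abs_div, abs_of_pos hh', mul_div_cancel₀ _ hh'.ne',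
    show p + 2 * h = p + h + h by ring, e2, e1]
  congr 1
  push_cast
  ring

lemma imb_count {m n h : ℕ} {c ε T : ℝ} (hh : 1 ≤ h) (hm : 0 < m) (A : Config m n) (hT : 0 < T) :
    (((Finset.range m).filter (fun p => IsLive c ε m A.1 p (2 * h) ∧ T < |Iv m h p A.1|)).card : ℝ)
      ≤ (h * m / T) * DeltaAvg c ε m A.1 (2 * h) := by
  set B := (Finset.range m).filter (fun p => IsLive c ε m A.1 p (2 * h) ∧ T < |Iv m h p A.1|)
  have h1 : (B.card : ℝ) * T ≤ ∑ p ∈ B, h * adjImbalance c ε m A.1 p (2 * h) := by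
    calc (B.card : ℝ) * T = ∑ p ∈ B, T := by simp
      _ ≤ _ := by
          apply Finset.sum_le_sum
          intro p hp
          have h2 := (Finset.mem_filter.1 hp).2
          unfold adjImbalance
          rw [if_pos h2.1, ← Iv_eq m h p hh]
          exact h2.2.le
  have h2 : ∑ p ∈ B, h * adjImbalance c ε m A.1 p (2 * h) ≤
      ∑ p ∈ Finset.range m, h * adjImbalance c ε m A.1 p (2 * h) := by
    apply Finset.sum_le_sum_of_subset_of_nonneg (Finset.filter_subset _ _)
    intro p _ _
    unfold adjImbalance imbalance
    split_ifs <;> positivity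
  simp only [← Finset.mul_sum] at h1 h2
  unfold DeltaAvg
  have hm' : (0 : ℝ) < m := by exact_mod_cast hm
  have : (h * m / T) * ((∑ p ∈ Finset.range m, adjImbalance c ε m A.1 p (2 * h)) / m)
      = (h * ∑ p ∈ Finset.range m, adjImbalance c ε m A.1 p (2 * h)) / T := by
    field_simp
  rw [this, le_div_iff₀ hT]
  linarith

lemma good_count {m n u : ℕ} {c ε T : ℝ} (hu : 1 ≤ u) (hm : 0 < m) (A : Config m n) (hT : 0 < T)
    (hc : 0 < c) (hε : 0 < ε) (hnm : n ≤ m) (hn : 0 < n)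
    (he : ε * m = (m : ℝ) - n) (hsz : m + 64 * u < n + n / 2 + 32 * u) (hsz2 : 32 * u ≤ n / 2) :
    (14 * u : ℝ) * (((n / 2 : ℕ) : ℝ) + 1 - 32 * u - ((n + 3) / 4 : ℕ) - 4 * (m - n) - m / c
      - (32 * u * m / T) * DeltaAvg c ε m A.1 (64 * u)) ≤
    ∑ r ∈ Finset.Icc ((n + 3) / 4) (n / 2), ∑ p ∈ Finset.range m,
      if Good (T + 1) m r (32 * u) u p A.1 then (1 : ℝ) else 0 := by
  set R0 := (n + 3) / 4
  set R1 := n / 2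
  set P := (Finset.range m).filter (fun p => cyc m A.1 p = true ∧ R0 ≤ Ncnt m A.1 p ∧
    Ncnt m A.1 p + 32 * u ≤ R1) with hP
  set B1 := (Finset.range m).filter
    (fun p => p + (32 * u - 1) < m ∧ ¬ cyc m A.1 (p + (32 * u - 1)) = true)
  set B2 := (Finset.range m).filter (fun p => p + 64 * u < m ∧ ¬ cyc m A.1 (p + 64 * u) = true)
  set B3 := (Finset.range m).filter
    (fun p => p + 64 * u < m ∧ blockCount m A.1 p (32 * u) < 16 * u)
  set B4 := (Finset.range m).filter (fun p => p + 64 * u < m ∧ ¬ IsLive c ε m A.1 p (64 * u))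
  set B5 := (Finset.range m).filter
    (fun p => IsLive c ε m A.1 p (2 * (32 * u)) ∧ T < |Iv m (32 * u) p A.1|)
  have hB1 : B1.card ≤ m - n := empty_shift A _
  have hB2 : B2.card ≤ m - n := empty_shift A _
  have hB3 : B3.card ≤ 2 * (m - n) := sparse_half hu A
  have hB4 : (B4.card : ℝ) ≤ m / c := dead_count (by omega) hc hε hnm he A
  have hB5 : (B5.card : ℝ) ≤ _ := imb_count (c := c) (ε := ε) (h := 32 * u) (by omega) hm A hT
  rw [show 2 * (32 * u) = 64 * u by ring] at hB5
  push_cast at hB5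
  have hPc : R1 - 32 * u + 1 ≤ P.card + R0 := by
    apply rank_count A R0 (R1 - 32 * u) (by omega)
    intro p h1 h2 h3 h4
    exact ⟨h2, h3, by omega⟩
  set G := P \ (B1 ∪ B2 ∪ B3 ∪ B4 ∪ B5) with hG
  have hGc : P.card ≤ G.card + (B1.card + B2.card + B3.card + B4.card + B5.card) := by
    have e1 := Finset.le_card_sdiff (B1 ∪ B2 ∪ B3 ∪ B4 ∪ B5) P
    have e2 := Finset.card_union_le (B1 ∪ B2 ∪ B3 ∪ B4) B5
    have e3 := Finset.card_union_le (B1 ∪ B2 ∪ B3) B4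
    have e4 := Finset.card_union_le (B1 ∪ B2) B3
    have e5 := Finset.card_union_le B1 B2
    rw [← hG] at e1
    omega
  have hlow : (G.card : ℝ) * (14 * u) ≤ ∑ r ∈ Finset.Icc R0 R1, ∑ p ∈ Finset.range m,
      if Good (T + 1) m r (32 * u) u p A.1 then (1 : ℝ) else 0 := by
    rw [Finset.sum_comm]
    calc (G.card : ℝ) * (14 * u) = ∑ p ∈ G, (14 * u : ℝ) := by simp
      _ ≤ ∑ p ∈ G, ∑ r ∈ Finset.Icc R0 R1,
            (if Good (T + 1) m r (32 * u) u p A.1 then (1 : ℝ) else 0) := by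
          apply Finset.sum_le_sum
          intro p hp
          rw [hG, Finset.mem_sdiff] at hp
          obtain ⟨hpP, hpB⟩ := hp
          simp only [Finset.mem_union, not_or] at hpB
          obtain ⟨⟨⟨⟨b1, b2⟩, b3⟩, b4⟩, b5⟩ := hpB
          obtain ⟨hpm, hocc, hp1, hp2⟩ := Finset.mem_filter.1 hpP
          have hpm' := Finset.mem_range.1 hpm
          have hpos := pos_le A hpm'
          have hj : p + 64 * u < m := by omega
          have b1' : cyc m A.1 (p + (32 * u - 1)) = true := by
            by_contra hh
            exact b1 (Finset.mem_filter.2 ⟨hpm, by omega, hh⟩)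
          have b2' : cyc m A.1 (p + 64 * u) = true := by
            by_contra hh
            exact b2 (Finset.mem_filter.2 ⟨hpm, by omega, hh⟩)
          have b3' : 16 * u ≤ blockCount m A.1 p (32 * u) := by
            by_contra hh
            exact b3 (Finset.mem_filter.2 ⟨hpm, by omega, by omega⟩)
          have b4' : IsLive c ε m A.1 p (64 * u) := by
            by_contra hh
            exact b4 (Finset.mem_filter.2 ⟨hpm, by omega, hh⟩)
          have b5' : |Iv m (32 * u) p A.1| ≤ T := by
            by_contra hh
            refine b5 (Finset.mem_filter.2 ⟨hpm, ?_, not_le.1 hh⟩)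
            rw [show 2 * (32 * u) = 64 * u by ring]
            exact b4'
          have e1 := Ncnt_add m A.1 p (32 * u)
          have e2 := blockCount_le m A.1 p (32 * u)
          rw [← Finset.sum_filter, Finset.sum_const, nsmul_eq_mul, mul_one]
          have hcard : 14 * u ≤ ((Finset.Icc R0 R1).filter
              (fun r => Good (T + 1) m r (32 * u) u p A.1)).card := by
            have : (Finset.Icc (Ncnt m A.1 p + 1 + u) (Ncnt m A.1 (p + 32 * u) - u)).card ≤
              ((Finset.Icc R0 R1).filter (fun r => Good (T + 1) m r (32 * u) u p A.1)).card := by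
              apply Finset.card_le_card
              intro r hr
              have hr' := Finset.mem_Icc.1 hr
              refine Finset.mem_filter.2 ⟨Finset.mem_Icc.2 ⟨by omega, by omega⟩, ?_, ?_, ?_⟩
              · refine ⟨by omega, hocc, ?_, ?_, by omega, by omega⟩
                · rw [show p + 32 * u - 1 = p + (32 * u - 1) by omega]; exact b1'
                · rw [show 2 * (32 * u) = 64 * u by ring]; exact b2'
              · have := (abs_le.1 b5').1
                linarith
              · have := (abs_le.1 b5').2
                linarith
            rw [Nat.card_Icc] at this
            omega
          exact_mod_cast hcard
      _ ≤ _ := by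
          apply Finset.sum_le_sum_of_subset_of_nonneg
          · intro p hp
            rw [hG, Finset.mem_sdiff] at hp
            exact (Finset.mem_filter.1 hp.1).1
          · intro p _ _
            apply Finset.sum_nonneg
            intro r _
            split_ifs <;> norm_num
  refine le_trans ?_ hlow
  rw [mul_comm]
  apply mul_le_mul_of_nonneg_right _ (by positivity)
  have q1 : (R1 : ℝ) + 1 ≤ P.card + R0 + 32 * u := by
    have : R1 + 1 ≤ P.card + R0 + 32 * u := by omega
    exact_mod_cast this
  have q2 : (P.card : ℝ) ≤ G.card + (B1.card + B2.card + B3.card + B4.card + B5.card) := by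
    exact_mod_cast hGc
  have q3 : (B1.card : ℝ) + B2.card + B3.card ≤ 4 * (m - n) := by
    rw [← Nat.cast_sub hnm]
    have : B1.card + B2.card + B3.card ≤ 4 * (m - n) := by omega
    exact_mod_cast this
  linarith

/-- Small block sizes. -/
lemma small_r {m n r j : ℕ} (Mo : HIModel m n) (h1 : 2 ≤ r) (hr : r + 1 ≤ n) (hj1 : 1 ≤ j)
    (hj : j ≤ 64) :
    pexp Mo.C0 (fun A => if ∃ x, x + 1 < m ∧ cyc m A.1 x = true ∧ cyc m A.1 (x + 1) = true ∧
      Ncnt m A.1 x + 2 = r then (1 : ℝ) else 0) ≤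
    Ex Mo r (fun a b c => (rearrCount (1/64) 2 m n r j a b c : ℝ)) := by
  have := Ex_potential Mo (r := r) (by omega) (by omega)
    (fun A => if ∃ x, x + 1 < m ∧ cyc m A.1 x = true ∧ cyc m A.1 (x + 1) = true ∧
      Ncnt m A.1 x + 2 = r then (1 : ℝ) else 0) (fun _ => 0) 1
    (fun a b c => (rearrCount (1/64) 2 m n r j a b c : ℝ)) ?_
  · simpa using this
  intro A0 A1 A2
  simp only [add_zero, zero_add, one_mul]
  split_ifs with hx
  · obtain ⟨x, hx1, hx2, hx3, hx4⟩ := hx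
    have hj' : (j : ℝ) ≤ 64 := by exact_mod_cast hj
    have hj1' : (1 : ℝ) ≤ j := by exact_mod_cast hj1
    have hs := Ncnt_succ hx2
    suffices h : 1 ≤ rearrCount (1/64) 2 m n r j A0 A1 A2 by exact_mod_cast h
    rw [rearrCount_eq, Nat.one_le_iff_ne_zero, Finset.card_ne_zero]
    by_contra hne
    rw [Finset.not_nonempty_iff_eq_empty] at hne
    have k1 : ¬ Rearr r A0 A1 A2 (r - 1) := by
      intro hR
      have : r - 1 ∈ rset (1/64) 2 r j A0 A1 A2 := by
        refine Finset.mem_filter.2 ⟨Finset.mem_Icc.2 ⟨by omega, by omega⟩, ?_, ?_, hR⟩ <;>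
        · rw [Nat.cast_sub (by omega)]
          norm_num
          linarith
      rw [hne] at this
      simp at this
    have k2 : ¬ Rearr r A0 A1 A2 (r + 1) := by
      intro hR
      have : r + 1 ∈ rset (1/64) 2 r j A0 A1 A2 := by
        refine Finset.mem_filter.2 ⟨Finset.mem_Icc.2 ⟨by omega, by omega⟩, ?_, ?_, hR⟩ <;>
        · push_cast
          norm_num
          linarith
      rw [hne] at this
      simp at this
    have l1 := not_rearr (by omega) hx2 (by unfold insShift; rw [if_pos] <;> omega) (by omega) k1
    have l2 := not_rearr (by omega) hx3 (by unfold insShift; rw [if_neg] <;> omega) (by omega) k2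
    have := Ncnt_succ l1.1
    omega
  · positivity

lemma small_count {m n : ℕ} (A : Config m n) (hn : 8 ≤ n) (hnm : n ≤ m) :
    ((Finset.Icc ((n + 3) / 4) (n / 2)).card : ℝ) - (m - n) ≤
    ∑ r ∈ Finset.Icc ((n + 3) / 4) (n / 2),
      if ∃ x, x + 1 < m ∧ cyc m A.1 x = true ∧ cyc m A.1 (x + 1) = true ∧
      Ncnt m A.1 x + 2 = r then (1 : ℝ) else 0 := by
  rw [← Finset.sum_filter, Finset.sum_const, nsmul_eq_mul, mul_one]
  set R0 := (n + 3) / 4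
  set R1 := n / 2
  set W := (Finset.Icc R0 R1).filter (fun r => ∃ x, x + 1 < m ∧ cyc m A.1 x = true ∧
    cyc m A.1 (x + 1) = true ∧ Ncnt m A.1 x + 2 = r) with hW
  set P := (Finset.range m).filter (fun p => cyc m A.1 p = true ∧ R0 ≤ Ncnt m A.1 p + 2 ∧
    Ncnt m A.1 p + 2 ≤ R1) with hP
  set B := (Finset.range m).filter (fun p => p + 1 < m ∧ ¬ cyc m A.1 (p + 1) = true)
  have hB : B.card ≤ m - n := empty_shift A _
  have hPc : R1 - 2 + 1 ≤ P.card + (R0 - 2) := by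
    apply rank_count A (R0 - 2) (R1 - 2) (by omega)
    intro p h1 h2 h3 h4
    exact ⟨h2, by omega, by omega⟩
  have hPB : (P \ B).card ≤ W.card := by
    apply Finset.card_le_card_of_injOn (fun p => Ncnt m A.1 p + 2)
    · intro p hp
      obtain ⟨hpP, hpB⟩ := Finset.mem_sdiff.1 hp
      obtain ⟨hpm, hocc, hp1, hp2⟩ := Finset.mem_filter.1 hpP
      have hpm' := Finset.mem_range.1 hpm
      have hpos := pos_le A hpm'
      have hj : p + 1 < m := by omega
      refine Finset.mem_filter.2 ⟨Finset.mem_Icc.2 ⟨hp1, hp2⟩, p, hj, hocc, ?_, rfl⟩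
      by_contra hh
      exact hpB (Finset.mem_filter.2 ⟨hpm, hj, hh⟩)
    · intro p hp q hq hpq
      obtain ⟨hpP, -⟩ := Finset.mem_sdiff.1 hp
      obtain ⟨hqP, -⟩ := Finset.mem_sdiff.1 hq
      exact Ncnt_inj (Finset.mem_filter.1 hpP).2.1 (Finset.mem_filter.1 hqP).2.1
        (by simpa using hpq)
  have e1 := Finset.le_card_sdiff B P
  rw [Nat.card_Icc, ← Nat.cast_sub hnm]
  have : R1 + 1 - R0 ≤ W.card + (m - n) := by omega
  have h2 : ((R1 + 1 - R0 : ℕ) : ℝ) ≤ W.card + (m - n : ℕ) := by exact_mod_cast this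
  linarith
theorem statement15 :
    ∃ c₀ : ℝ, 10 ≤ c₀ ∧ ∃ c₁ c₂ c₃ : ℝ, 0 < c₁ ∧ c₁ < c₂ ∧ 0 < c₃ ∧
      ∀ c : ℝ, c₀ ≤ c → ∃ M : ℕ, ∀ m : ℕ, M ≤ m →
      ∀ n : ℕ, n ≤ m →
      ((m : ℝ) ^ (-(1 : ℝ) / 3) ≤ 1 - (n : ℝ) / m) → (1 - (n : ℝ) / m ≤ 1 / c) →
      ∀ Mo : HIModel m n, ∀ j ∈ Jset m,
      c₃ / (DeltaExp c Mo j + 1 / j) ≤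
        (1 / ((Finset.Icc ((n + 3) / 4) (n / 2)).card : ℝ)) *
          ∑ r ∈ Finset.Icc ((n + 3) / 4) (n / 2),
            pexp Mo.C0 (fun A =>
              pexp (condFst (Mo.ins r) A) (fun q =>
                pexp (condSnd Mo.del q.2) (fun q' =>
                  (rearrCount c₁ c₂ m n r j q.1 q.2 q'.1 : ℝ)))) := by
  refine ⟨200, by norm_num, 1/64, 2, 1/10000, by norm_num, by norm_num, by norm_num, ?_⟩
  intro c hc
  refine ⟨1000, ?_⟩
  intro m hm n hnm hε1 hε2 Mo j hj
  set ε : ℝ := 1 - (n : ℝ) / m with hεdef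
  have hm0 : (0 : ℝ) < m := by
    have : 0 < m := by omega
    exact_mod_cast this
  have hmR : (1000 : ℝ) ≤ m := by exact_mod_cast hm
  have hε : 0 < ε := lt_of_lt_of_le (Real.rpow_pos_of_pos hm0 _) hε1
  have he : ε * m = (m : ℝ) - n := by rw [hεdef]; field_simp
  have hc0 : 0 < c := by linarith
  have hmc : (m : ℝ) / c ≤ m / 200 := div_le_div_of_nonneg_left hm0.le (by norm_num) hc
  have hmn : (m : ℝ) - n ≤ m / 200 := by
    rw [← he]
    refine le_trans ?_ hmc
    rw [div_eq_mul_one_div, mul_comm]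
    exact mul_le_mul_of_nonneg_left hε2 hm0.le
  have hmnN : 199 * m ≤ 200 * n := by
    have : (199 : ℝ) * m ≤ 200 * n := by linarith
    exact_mod_cast this
  have hD : 0 ≤ DeltaExp c Mo j := by
    have := pexp_mono Mo.C0 (f := fun _ => (0 : ℝ))
      (g := fun A => DeltaAvg c (1 - (n : ℝ) / m) m A.1 j) (by
        intro A
        unfold DeltaAvg
        apply div_nonneg _ hm0.le
        apply Finset.sum_nonneg
        intro p _
        unfold adjImbalance imbalance
        split_ifs <;> positivity)
    rw [pexp_const] at this
    exact this
  change _ ≤ (1 / ((Finset.Icc ((n + 3) / 4) (n / 2)).card : ℝ)) *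
    ∑ r ∈ Finset.Icc ((n + 3) / 4) (n / 2),
      Ex Mo r (fun a b c => (rearrCount (1/64) 2 m n r j a b c : ℝ))
  have hRc : (Finset.Icc ((n + 3) / 4) (n / 2)).card = n / 2 + 1 - (n + 3) / 4 := Nat.card_Icc _ _
  have hRlo : (m : ℝ) / 10 ≤ ((Finset.Icc ((n + 3) / 4) (n / 2)).card : ℝ) := by
    rw [hRc]
    have : m ≤ 10 * (n / 2 + 1 - (n + 3) / 4) := by omega
    have h2 : (m : ℝ) ≤ 10 * (n / 2 + 1 - (n + 3) / 4 : ℕ) := by exact_mod_cast this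
    linarith
  have hRhi : ((Finset.Icc ((n + 3) / 4) (n / 2)).card : ℝ) ≤ m / 2 := by
    rw [hRc]
    have : 2 * (n / 2 + 1 - (n + 3) / 4) ≤ m := by omega
    have h2 : 2 * ((n / 2 + 1 - (n + 3) / 4 : ℕ) : ℝ) ≤ m := by exact_mod_cast this
    linarith
  set Rc : ℝ := ((Finset.Icc ((n + 3) / 4) (n / 2)).card : ℝ) with hRcdef
  have hRpos : 0 < Rc := by linarith
  obtain ⟨i, hi, rfl⟩ := Finset.mem_image.1 hj
  rw [Finset.mem_Icc] at hi
  set D := DeltaExp c Mo (2 ^ i) with hDdef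
  set S := ∑ r ∈ Finset.Icc ((n + 3) / 4) (n / 2),
      Ex Mo r (fun a b c => (rearrCount (1/64) 2 m n r (2 ^ i) a b c : ℝ)) with hSdef
  have hjpos : (0 : ℝ) < ((2 ^ i : ℕ) : ℝ) := by positivity
  by_cases h6 : i < 6
  · have hjN : 2 ^ i ≤ 64 := by
      calc 2 ^ i ≤ 2 ^ 6 := Nat.pow_le_pow_right (by norm_num) h6.le
        _ = 64 := by norm_num
    have hjR : ((2 ^ i : ℕ) : ℝ) ≤ 64 := by exact_mod_cast hjN
    have hS : Rc - (m - n) ≤ S := by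
      calc Rc - (m - n) = pexp Mo.C0 (fun _ => Rc - (m - n)) := (pexp_const _ _).symm
        _ ≤ _ := pexp_mono _ (fun A => small_count A (by omega) hnm)
        _ = _ := pexp_sum _ _ _
        _ ≤ S := by
          apply Finset.sum_le_sum
          intro r hr
          rw [Finset.mem_Icc] at hr
          exact small_r Mo (by omega) (by omega) Nat.one_le_two_pow hjN
    have h1 : (1/10000 : ℝ) / (D + 1 / ((2 ^ i : ℕ) : ℝ)) ≤ 1 / 2 := by
      rw [div_le_iff₀ (by positivity)]
      have : (1 : ℝ) / 64 ≤ 1 / ((2 ^ i : ℕ) : ℝ) := one_div_le_one_div_of_le hjpos hjR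
      linarith
    refine h1.trans ?_
    rw [one_div_mul_eq_div, le_div_iff₀ hRpos]
    linarith
  · set u := 2 ^ (i - 6) with hu
    have hju : 2 ^ i = 64 * u := by
      rw [hu, show (64 : ℕ) = 2 ^ 6 by norm_num, ← pow_add]
      congr 1
      omega
    have hu1 : 1 ≤ u := Nat.one_le_two_pow
    have hjm : 4 * (64 * u) ≤ m := by
      rw [← hju]
      calc 4 * 2 ^ i = 2 ^ (i + 2) := by ring
        _ ≤ 2 ^ (Nat.log 2 m) := Nat.pow_le_pow_right (by norm_num) (by omega)
        _ ≤ m := Nat.pow_log_le_self 2 (by omega)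
    rw [hju] at hDdef hSdef hjpos ⊢
    have huR : (1 : ℝ) ≤ u := by exact_mod_cast hu1
    have hjmR : 256 * (u : ℝ) ≤ m := by
      have : 256 * u ≤ m := by omega
      exact_mod_cast this
    set Z : ℝ := 64 * u * D + 1 with hZ
    have hZ1 : 1 ≤ Z := by
      have : 0 ≤ 64 * u * D := by positivity
      linarith
    set T : ℝ := 20 * Z with hT
    have hTpos : 0 < T := by linarith
    have main1 : (14 * u : ℝ) * (((n / 2 : ℕ) : ℝ) + 1 - 32 * u - ((n + 3) / 4 : ℕ) - 4 * (m - n)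
        - m / c - (32 * u * m / T) * D) ≤ (3 * (2 * (T + 1) + 1)) * S := by
      set X : ℝ := ((n / 2 : ℕ) : ℝ) + 1 - 32 * u - ((n + 3) / 4 : ℕ) - 4 * (m - n) - m / c with hX
      calc (14 * u : ℝ) * (X - (32 * u * m / T) * D)
          = pexp Mo.C0 (fun A => 14 * u * X
              + (-(14 * u * (32 * u * m / T))) * DeltaAvg c ε m A.1 (64 * u)) := by
            rw [pexp_add, pexp_const, pexp_smul, hDdef]
            unfold DeltaExp
            ring
        _ ≤ _ := pexp_mono _ (fun A => by
            have := good_count hu1 (by omega : 0 < m) A hTpos hc0 hε hnm (by omega) he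
              (by omega) (by omega)
            refine le_trans (le_of_eq ?_) this
            rw [hX]
            ring)
        _ = _ := pexp_sum _ _ _
        _ ≤ ∑ r ∈ Finset.Icc ((n + 3) / 4) (n / 2), (3 * (2 * (T + 1) + 1)) *
              Ex Mo r (fun a b c => (rearrCount (1/64) 2 m n r (64 * u) a b c : ℝ)) := by
            apply Finset.sum_le_sum
            intro r hr
            rw [Finset.mem_Icc] at hr
            exact main_r (by linarith) Mo (by omega) hu1 (by omega)
        _ = _ := by rw [← Finset.mul_sum, ← hSdef]
    have e1 : (32 * u * m / T) * D ≤ m / 40 := by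
      rw [div_mul_eq_mul_div, div_le_div_iff₀ hTpos (by norm_num), hT, hZ]
      have : 0 ≤ (m : ℝ) * (u * D) := by positivity
      nlinarith
    have e2 : (n : ℝ) / 4 - 1 ≤ ((n / 2 : ℕ) : ℝ) + 1 - ((n + 3) / 4 : ℕ) := by
      have : n + 4 * ((n + 3) / 4) ≤ 4 * (n / 2) + 8 := by omega
      have h2 : (n : ℝ) + 4 * ((n + 3) / 4 : ℕ) ≤ 4 * (n / 2 : ℕ) + 8 := by exact_mod_cast this
      linarith
    have e3 : (7 / 100 : ℝ) * m ≤ ((n / 2 : ℕ) : ℝ) + 1 - 32 * u - ((n + 3) / 4 : ℕ) - 4 * (m - n)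
        - m / c - (32 * u * m / T) * D := by linarith
    have e4 : (14 * u : ℝ) * ((7 / 100 : ℝ) * m) ≤ (3 * (2 * (T + 1) + 1)) * S :=
      le_trans (mul_le_mul_of_nonneg_left e3 (by positivity)) main1
    have hSnn : 0 ≤ S := by
      rw [hSdef]
      apply Finset.sum_nonneg
      intro r _
      have := Ex_mono Mo r (F := fun _ _ _ => (0 : ℝ))
        (G := fun a b c => (rearrCount (1/64) 2 m n r (64 * u) a b c : ℝ))
        (fun a b c => by positivity)
      refine le_trans (le_of_eq ?_) this
      simp [Ex, pexp_const]
    have e5 : (3 * (2 * (T + 1) + 1)) * S ≤ 129 * Z * S :=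
      mul_le_mul_of_nonneg_right (by rw [hT]; linarith) hSnn
    have e6 : (1/10000 : ℝ) / (D + 1 / ((64 * u : ℕ) : ℝ)) = (64 / 10000 * u) / Z := by
      push_cast
      rw [hZ]
      field_simp
    rw [e6, one_div_mul_eq_div, div_le_div_iff₀ (by linarith) hRpos]
    have e7 : (64 / 10000 * u : ℝ) * Rc ≤ (64 / 10000 * u) * (m / 2) :=
      mul_le_mul_of_nonneg_left hRhi (by positivity)
    have e8 : 0 ≤ (u : ℝ) * m := by positivity
    have e9 : (98 / 100 : ℝ) * (u * m) ≤ 129 * (S * Z) := by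
      calc (98 / 100 : ℝ) * (u * m) = (14 * u : ℝ) * ((7 / 100 : ℝ) * m) := by ring
        _ ≤ 129 * Z * S := e4.trans e5
        _ = _ := by ring
    have e10 : (64 / 10000 * u : ℝ) * (m / 2) = 32 / 10000 * (u * m) := by ring
    rw [e10] at e7
    refine e7.trans ?_
    linarith
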